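/- Suppose sequences (x_k), (γ_k), (α_k), (p_k), (Φ_k) are generated by the nonmonotone proximal gradient method with backtracking information, and assume ∇f is locally Lipschitz continuous (every point of X has a neighborhood on which ∇f is Lipschitz). If the set of accumulation points of the sequence (x_k) is nonempty and bounded, then there exists γ_* > 0 with γ_k ≥ γ_* for all k ≥ 1, and for every k ≥ 1, min_{1≤j≤k} ‖x_j − x_{j−1}‖/γ_j ≤ (1/√k)·( 2·(φ(x_0) − φ_*) / (γ_*·p_min·(1 − α_max)) )^{1/2}, where φ_* denotes the (existing, finite) limit of the nonincreasing sequence (Φ_k). -/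

import Mathlib

open Filter Topology
open scoped RealInnerProductSpace

variable {X : Type*} [NormedAddCommGroup X] [InnerProductSpace ℝ X] [FiniteDimensional ℝ X]

/-- The extended-real-valued composite objective `φ = f + g`. -/
noncomputable def phiE (f : X → ℝ) (g : X → EReal) (z : X) : EReal :=
  (f z : EReal) + g z

/-- `y` minimizes `z ↦ g z + ⟪v, z - x⟫ + ‖z - x‖² / (2γ)` over `X`
(a proximal gradient step from `x` with gradient vector `v` and stepsize `γ`). -/
def ProxMin (g : X → EReal) (v x : X) (γ : ℝ) (y : X) : Prop :=
  ∀ z : X,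
    g y + ((⟪v, y - x⟫ + ‖y - x‖ ^ 2 / (2 * γ) : ℝ) : EReal) ≤
      g z + ((⟪v, z - x⟫ + ‖z - x‖ ^ 2 / (2 * γ) : ℝ) : EReal)

/-- Fréchet (regular) subgradient of `h` at `xb`. -/
noncomputable def FSubgrad (h : X → EReal) (xb v : X) : Prop :=
  h xb ≠ ⊤ ∧
    0 ≤ Filter.liminf
        (fun z : X => (h z - h xb - ((⟪v, z - xb⟫ : ℝ) : EReal)) / ((‖z - xb‖ : ℝ) : EReal))
        (𝓝[≠] xb)

/-- Limiting (Mordukhovich) subgradient of `h` at `xb`. -/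
noncomputable def MSubgrad (h : X → EReal) (xb v : X) : Prop :=
  h xb ≠ ⊤ ∧
    ∃ xs vs : ℕ → X,
      Tendsto xs atTop (𝓝 xb) ∧ Tendsto vs atTop (𝓝 v) ∧
        Tendsto (fun j => h (xs j)) atTop (𝓝 (h xb)) ∧ ∀ j, FSubgrad h (xs j) (vs j)

/-- The sequences `x, γ, α, p, Φ` are generated by the nonmonotone proximal gradient
method for `φ = f + g` with parameters `γmax, αmin, αmax, pmin`. -/
structure NMPG (f : X → ℝ) (g : X → EReal) (γmax αmin αmax pmin : ℝ)
    (x : ℕ → X) (γ α p : ℕ → ℝ) (Φ : ℕ → ℝ) : Prop where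
  hf : ContDiff ℝ 1 f
  hg_nebot : ∀ z, g z ≠ ⊥
  hg_proper : ∃ z, g z ≠ ⊤
  hg_lsc : LowerSemicontinuous g
  hg_proxbdd : ∃ γ₀ : ℝ, 0 < γ₀ ∧ ∃ m : ℝ, ∀ z,
    (m : EReal) ≤ g z + ((‖z‖ ^ 2 / (2 * γ₀) : ℝ) : EReal)
  hφ_bdd : ∃ m : ℝ, ∀ z, (m : EReal) ≤ phiE f g z
  hγmax : 0 < γmax
  hαmin : 0 < αmin
  hαα : αmin ≤ αmax
  hαmax : αmax < 1
  hpmin : 0 < pmin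
  hpone : pmin ≤ 1
  hx0 : g (x 0) ≠ ⊤
  hΦ0 : (Φ 0 : EReal) = phiE f g (x 0)
  hγpos : ∀ k, 0 < γ k
  hγle : ∀ k, γ k ≤ γmax
  hαmem : ∀ k, α k ∈ Set.Icc αmin αmax
  hpmem : ∀ k, p k ∈ Set.Icc pmin 1
  hstep : ∀ k : ℕ, ProxMin g (gradient f (x k)) (x k) (γ (k + 1)) (x (k + 1))
  hls : ∀ k : ℕ, phiE f g (x (k + 1)) ≤
      ((Φ k - (1 - α (k + 1)) / (2 * γ (k + 1)) * ‖x (k + 1) - x k‖ ^ 2 : ℝ) : EReal)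
  hΦrec : ∀ k : ℕ, Φ (k + 1) = (1 - p (k + 1)) * Φ k + p (k + 1) * (phiE f g (x (k + 1))).toReal

/-- Backtracking information: for every `k`, either `γ k ≥ γmin`, or the previously
attempted stepsize `σ ∈ [γ k / βmax, γ k / βmin]` was rejected by the line search. -/
def Backtrack (f : X → ℝ) (g : X → EReal) (αmin γmin βmin βmax : ℝ)
    (x : ℕ → X) (γ : ℕ → ℝ) (Φ : ℕ → ℝ) : Prop :=
  ∀ k : ℕ, γmin ≤ γ (k + 1) ∨
    ∃ σ : ℝ, ∃ y : X, γ (k + 1) / βmax ≤ σ ∧ σ ≤ γ (k + 1) / βmin ∧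
      ProxMin g (gradient f (x k)) (x k) σ y ∧
      ((Φ k - (1 - αmin) / (2 * σ) * ‖y - x k‖ ^ 2 : ℝ) : EReal) < phiE f g y

/-- A sequence whose steps vanish is bounded as soon as its set of accumulation points is
nonempty and bounded. -/
theorem exists_norm_le_of_steps_tendsto_zero {E : Type*} [NormedAddCommGroup E] [ProperSpace E]
    {x : ℕ → E} (hstep : Tendsto (fun k => ‖x (k + 1) - x k‖) atTop (𝓝 0))
    (hne : ({y : E | ∃ ks : ℕ → ℕ, StrictMono ks ∧
      Tendsto (fun j => x (ks j)) atTop (𝓝 y)} : Set E).Nonempty)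
    (hbdd : Bornology.IsBounded ({y : E | ∃ ks : ℕ → ℕ, StrictMono ks ∧
      Tendsto (fun j => x (ks j)) atTop (𝓝 y)} : Set E)) :
    ∃ R, ∀ k, ‖x k‖ ≤ R := by
  obtain ⟨M, hM⟩ := hbdd.exists_norm_le
  obtain ⟨a, ks, hks, ha⟩ := hne
  have haM : ‖a‖ ≤ M := hM a ⟨ks, hks, ha⟩
  let s : Set E := Metric.closedBall 0 (M + 2) \ Metric.ball 0 (M + 1)
  have hs : IsCompact s := (isCompact_closedBall 0 (M + 2)).diff Metric.isOpen_ball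
  have hnot : ∀ᶠ n in atTop, x n ∉ s := by
    by_contra hcon
    obtain ⟨b, hb, ψ, hψ, hlim⟩ := hs.tendsto_subseq' (x := x) hcon
    have h1 : ‖b‖ ≤ M := hM b ⟨ψ, hψ, hlim⟩
    have h2 : M + 1 ≤ ‖b‖ := by simpa using hb.2
    linarith
  obtain ⟨N, hN⟩ := eventually_atTop.1
    (hnot.and (hstep.eventually (gt_mem_nhds (zero_lt_one' ℝ))))
  obtain ⟨j, hj1, hj2⟩ := ((ha.norm.eventually (gt_mem_nhds (show ‖a‖ < M + 1 by linarith))).and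
    (hks.tendsto_atTop.eventually (eventually_ge_atTop N))).exists
  have key : ∀ n, ks j ≤ n → ‖x n‖ < M + 1 := by
    intro n hn
    induction n, hn using Nat.le_induction with
    | base => exact hj1
    | succ n hn ih =>
      have h1 := (hN n (hj2.trans hn)).2
      have h2 := (hN (n + 1) (by lia)).1
      have h3 := norm_sub_norm_le (x (n + 1)) (x n)
      by_contra hcon
      refine h2 ⟨?_, ?_⟩
      · simp only [Metric.mem_closedBall, dist_zero_right]
        linarith
      · simpa using hcon
  obtain ⟨B, hB⟩ := ((Set.finite_Iio (ks j)).image fun n => ‖x n‖).bddAbove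
  refine ⟨max B (M + 1), fun k => ?_⟩
  rcases lt_or_ge k (ks j) with hk | hk
  · exact le_max_of_le_left (hB ⟨k, hk, rfl⟩)
  · exact le_max_of_le_right (key k hk).le

/-- A descent inequality on a convex set where the gradient is Lipschitz. -/
theorem le_add_inner_gradient_add_of_lipschitzOnWith {f : X → ℝ} (hf : Differentiable ℝ f)
    {s : Set X} (hs : Convex ℝ s) {K : NNReal} (hK : LipschitzOnWith K (gradient f) s) {x y : X}
    (hx : x ∈ s) (hy : y ∈ s) :
    f y ≤ f x + ⟪gradient f x, y - x⟫ + K * ‖y - x‖ ^ 2 := by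
  have hseg : segment ℝ x y ⊆ s := hs.segment_subset hx hy
  have hmv := (convex_segment x y).norm_image_sub_le_of_norm_hasFDerivWithin_le'
    (f := f) (f' := fun z => InnerProductSpace.toDual ℝ X (gradient f z))
    (φ := InnerProductSpace.toDual ℝ X (gradient f x)) (C := K * ‖y - x‖)
    (fun z _ => (hf z).hasGradientAt.hasFDerivAt.hasFDerivWithinAt)
    (fun z hz => by
      rw [← map_sub, LinearIsometryEquiv.norm_map]
      refine (hK.norm_sub_le (hseg hz) hx).trans ?_
      gcongr
      exact norm_sub_le_of_mem_segment hz)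
    (left_mem_segment ℝ x y) (right_mem_segment ℝ x y)
  have := (le_abs_self _).trans hmv
  rw [InnerProductSpace.toDual_apply_apply] at this
  nlinarith

/-- For small stepsizes `σ`, a displacement `d` satisfying the quadratic bound coming from a
proximal step is at most `1`. -/
theorem exists_stepsize_forall_le_one {γ₀ : ℝ} (hγ₀ : 0 < γ₀) (m R V C : ℝ) :
    ∃ σ₀ : ℝ, 0 < σ₀ ∧ ∀ σ d : ℝ, 0 < σ → σ ≤ σ₀ → 0 ≤ d →
      m - (R + d) ^ 2 / (2 * γ₀) - V * d + d ^ 2 / (2 * σ) ≤ C → d ≤ 1 := by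
  set A : ℝ := |C - m| + R ^ 2 / γ₀ + V ^ 2 / 2 + 1 with hA
  set B : ℝ := 1 / γ₀ + 1 / 2 with hB
  have hApos : 0 < A := by positivity
  have hBpos : 0 < B := by positivity
  refine ⟨1 / (2 * (A + B)), by positivity, fun σ d hσ hσle hd hq => ?_⟩
  have h1 : A + B ≤ 1 / (2 * σ) := by
    rw [le_div_iff₀ (by positivity)] at hσle ⊢
    linarith
  have h2 : (A + B) * d ^ 2 ≤ d ^ 2 / (2 * σ) := by
    have := mul_le_mul_of_nonneg_right h1 (sq_nonneg d)
    rwa [one_div_mul_eq_div] at this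
  have h3 : (R + d) ^ 2 / (2 * γ₀) ≤ R ^ 2 / γ₀ + 1 / γ₀ * d ^ 2 := by
    have : R ^ 2 / γ₀ + 1 / γ₀ * d ^ 2 - (R + d) ^ 2 / (2 * γ₀) = (R - d) ^ 2 / (2 * γ₀) := by
      field_simp
      ring
    have h0 : 0 ≤ (R - d) ^ 2 / (2 * γ₀) := by positivity
    linarith
  have h4 : V * d ≤ V ^ 2 / 2 + 1 / 2 * d ^ 2 := by nlinarith [sq_nonneg (V - d)]
  have h5 := le_abs_self (C - m)
  have h6 : A * d ^ 2 ≤ A * 1 := by nlinarith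
  have h7 := le_of_mul_le_mul_left h6 hApos
  nlinarith

namespace NMPG

variable {f : X → ℝ} {g : X → EReal} {γmax αmin αmax pmin : ℝ}
  {x : ℕ → X} {γ α p Φ : ℕ → ℝ}

theorem g_ne_top (h : NMPG f g γmax αmin αmax pmin x γ α p Φ) (k : ℕ) : g (x k) ≠ ⊤ := by
  cases k with
  | zero => exact h.hx0
  | succ k =>
    intro htop
    have := h.hls k
    rw [phiE, htop, EReal.coe_add_top] at this
    exact absurd this (not_le.2 (EReal.coe_lt_top _))

theorem coe_toReal_g (h : NMPG f g γmax αmin αmax pmin x γ α p Φ) (k : ℕ) :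
    ((g (x k)).toReal : EReal) = g (x k) :=
  EReal.coe_toReal (h.g_ne_top k) (h.hg_nebot _)

theorem phiE_eq (h : NMPG f g γmax αmin αmax pmin x γ α p Φ) (k : ℕ) :
    phiE f g (x k) = ((f (x k) + (g (x k)).toReal : ℝ) : EReal) := by
  rw [phiE, EReal.coe_add, h.coe_toReal_g]

theorem lineSearch (h : NMPG f g γmax αmin αmax pmin x γ α p Φ) (k : ℕ) :
    f (x (k + 1)) + (g (x (k + 1))).toReal ≤
      Φ k - (1 - α (k + 1)) / (2 * γ (k + 1)) * ‖x (k + 1) - x k‖ ^ 2 := by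
  have := h.hls k
  rw [h.phiE_eq] at this
  exact_mod_cast this

theorem merit_succ (h : NMPG f g γmax αmin αmax pmin x γ α p Φ) (k : ℕ) :
    Φ (k + 1) = (1 - p (k + 1)) * Φ k +
      p (k + 1) * (f (x (k + 1)) + (g (x (k + 1))).toReal) := by
  rw [h.hΦrec, h.phiE_eq, EReal.toReal_coe]

theorem merit_zero (h : NMPG f g γmax αmin αmax pmin x γ α p Φ) :
    Φ 0 = f (x 0) + (g (x 0)).toReal := by
  have := h.hΦ0
  rw [h.phiE_eq] at this
  exact_mod_cast this

theorem sufficient_decrease (h : NMPG f g γmax αmin αmax pmin x γ α p Φ) (k : ℕ) :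
    pmin * ((1 - αmax) / (2 * γ (k + 1)) * ‖x (k + 1) - x k‖ ^ 2) ≤ Φ k - Φ (k + 1) := by
  have hγ := h.hγpos (k + 1)
  have hα := (h.hαmem (k + 1)).2
  have hp := (h.hpmem (k + 1)).1
  have hαmax : 0 < 1 - αmax := sub_pos.2 h.hαmax
  have h1 : (1 - αmax) / (2 * γ (k + 1)) * ‖x (k + 1) - x k‖ ^ 2 ≤
      (1 - α (k + 1)) / (2 * γ (k + 1)) * ‖x (k + 1) - x k‖ ^ 2 := by gcongr
  have h2 := h.lineSearch k
  have hpmin := h.hpmin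
  calc pmin * ((1 - αmax) / (2 * γ (k + 1)) * ‖x (k + 1) - x k‖ ^ 2)
      ≤ p (k + 1) * ((1 - αmax) / (2 * γ (k + 1)) * ‖x (k + 1) - x k‖ ^ 2) := by gcongr
    _ ≤ p (k + 1) * (Φ k - (f (x (k + 1)) + (g (x (k + 1))).toReal)) := by
        refine mul_le_mul_of_nonneg_left ?_ (hpmin.le.trans hp)
        linarith
    _ = Φ k - Φ (k + 1) := by
        rw [h.merit_succ k]
        ring

theorem merit_antitone (h : NMPG f g γmax αmin αmax pmin x γ α p Φ) : Antitone Φ := by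
  refine antitone_nat_of_succ_le fun k => ?_
  have hγ := h.hγpos (k + 1)
  have hαmax : 0 < 1 - αmax := sub_pos.2 h.hαmax
  have hpmin := h.hpmin
  have h0 : 0 ≤ pmin * ((1 - αmax) / (2 * γ (k + 1)) * ‖x (k + 1) - x k‖ ^ 2) := by positivity
  linarith [h.sufficient_decrease k]

theorem objective_le_merit (h : NMPG f g γmax αmin αmax pmin x γ α p Φ) (k : ℕ) :
    f (x k) + (g (x k)).toReal ≤ Φ k := by
  cases k with
  | zero => exact h.merit_zero.ge
  | succ k =>
    have hγ := h.hγpos (k + 1)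
    have hα : 0 ≤ 1 - α (k + 1) := by linarith [(h.hαmem (k + 1)).2, h.hαmax]
    have h0 : 0 ≤ (1 - α (k + 1)) / (2 * γ (k + 1)) * ‖x (k + 1) - x k‖ ^ 2 := by positivity
    have h1 := h.lineSearch k
    have hp := (h.hpmem (k + 1)).2
    rw [h.merit_succ k]
    nlinarith

theorem tendsto_step_zero (h : NMPG f g γmax αmin αmax pmin x γ α p Φ) {φstar : ℝ}
    (hΦ : Tendsto Φ atTop (𝓝 φstar)) :
    Tendsto (fun k => ‖x (k + 1) - x k‖) atTop (𝓝 0) := by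
  have hαmax : 0 < 1 - αmax := sub_pos.2 h.hαmax
  have hpmin := h.hpmin
  have hγmax := h.hγmax
  have hc : 0 < pmin * ((1 - αmax) / (2 * γmax)) := by positivity
  have hlim : Tendsto (fun k => (Φ k - Φ (k + 1)) / (pmin * ((1 - αmax) / (2 * γmax))))
      atTop (𝓝 0) := by
    simpa using (hΦ.sub (hΦ.comp (tendsto_add_atTop_nat 1))).div_const
      (pmin * ((1 - αmax) / (2 * γmax)))
  have hsq : Tendsto (fun k => ‖x (k + 1) - x k‖ ^ 2) atTop (𝓝 0) := by
    refine squeeze_zero (fun k => by positivity) (fun k => ?_) hlim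
    rw [le_div_iff₀ hc]
    refine le_trans ?_ (h.sufficient_decrease k)
    have hγ := h.hγpos (k + 1)
    have hγle := h.hγle (k + 1)
    calc ‖x (k + 1) - x k‖ ^ 2 * (pmin * ((1 - αmax) / (2 * γmax)))
        = pmin * ((1 - αmax) / (2 * γmax) * ‖x (k + 1) - x k‖ ^ 2) := by ring
      _ ≤ _ := by gcongr
  simpa using hsq.sqrt

/-- If the iterates stay bounded, the stepsizes are bounded away from zero. -/
theorem exists_stepsize_lower_bound (h : NMPG f g γmax αmin αmax pmin x γ α p Φ)
    {γmin βmin βmax : ℝ} (hγmin : 0 < γmin) (hβmin : 0 < βmin) (hββ : βmin ≤ βmax)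
    (hbt : Backtrack f g αmin γmin βmin βmax x γ Φ) (hLip : LocallyLipschitz (gradient f))
    {R : ℝ} (hR : ∀ k, ‖x k‖ ≤ R) :
    ∃ γstar : ℝ, 0 < γstar ∧ ∀ k, γstar ≤ γ (k + 1) := by
  have hβmax : 0 < βmax := hβmin.trans_le hββ
  obtain ⟨K, hK⟩ := (hLip.locallyLipschitzOn
    (s := Metric.closedBall 0 (R + 1))).exists_lipschitzOnWith_of_compact
    (isCompact_closedBall (0 : X) (R + 1))
  obtain ⟨V, hV⟩ := (isCompact_closedBall (0 : X) R).exists_bound_of_continuousOn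
    hLip.continuous.continuousOn
  obtain ⟨F, hF⟩ := (isCompact_closedBall (0 : X) R).exists_bound_of_continuousOn
    h.hf.continuous.continuousOn
  obtain ⟨γ₀, hγ₀, m, hm⟩ := h.hg_proxbdd
  obtain ⟨σ₀, hσ₀, hσ₀d⟩ := exists_stepsize_forall_le_one hγ₀ m R V (Φ 0 + F)
  have hαmin := h.hαmin
  refine ⟨min γmin (βmin * min σ₀ (αmin / (2 * (K + 1)))), by positivity, fun k => ?_⟩
  rcases hbt k with hk | ⟨σ, y, hσ1, hσ2, hprox, hrej⟩
  · exact (min_le_left _ _).trans hk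
  refine (min_le_right _ _).trans ?_
  by_contra! hlt
  have hσpos : 0 < σ := (div_pos (h.hγpos (k + 1)) hβmax).trans_le hσ1
  have hσlt : σ < min σ₀ (αmin / (2 * (K + 1))) := by
    rw [le_div_iff₀ hβmin] at hσ2
    by_contra! hcon
    nlinarith
  have hy_top : g y ≠ ⊤ := by
    intro htop
    have := hprox (x k)
    rw [htop, EReal.top_add_coe, ← h.coe_toReal_g k, ← EReal.coe_add] at this
    exact absurd this (not_le.2 (EReal.coe_lt_top _))
  have hgy : ((g y).toReal : EReal) = g y := EReal.coe_toReal hy_top (h.hg_nebot _)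
  set G : ℝ := (g y).toReal
  set d : ℝ := ‖y - x k‖ with hd
  have hmin : G + (⟪gradient f (x k), y - x k⟫ + d ^ 2 / (2 * σ)) ≤ (g (x k)).toReal := by
    have := hprox (x k)
    rw [← h.coe_toReal_g k, ← hgy] at this
    simp only [sub_self, inner_zero_right, norm_zero, ne_eq, OfNat.ofNat_ne_zero,
      not_false_eq_true, zero_pow, zero_div, add_zero, EReal.coe_zero] at this
    exact_mod_cast this
  have hlow : m ≤ G + ‖y‖ ^ 2 / (2 * γ₀) := by
    have := hm y
    rw [← hgy] at this
    exact_mod_cast this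
  have hxk : x k ∈ Metric.closedBall (0 : X) R := by simpa using hR k
  have hyd : ‖y‖ ≤ R + d := by
    have := norm_le_norm_add_norm_sub' y (x k)
    linarith [hR k]
  have hd1 : d ≤ 1 := by
    refine hσ₀d σ d hσpos (hσlt.le.trans (min_le_left _ _)) (norm_nonneg _) ?_
    have h1 : -(V * d) ≤ ⟪gradient f (x k), y - x k⟫ := by
      exact neg_le_of_abs_le ((abs_real_inner_le_norm (gradient f (x k)) (y - x k)).trans
        (mul_le_mul_of_nonneg_right (hV _ hxk) (norm_nonneg _)))
    have h2 : ‖y‖ ^ 2 / (2 * γ₀) ≤ (R + d) ^ 2 / (2 * γ₀) := by gcongr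
    have h3 := neg_le_of_abs_le (hF _ hxk)
    have h4 := h.objective_le_merit k
    have h5 := h.merit_antitone (Nat.zero_le k)
    linarith
  have hdesc := le_add_inner_gradient_add_of_lipschitzOnWith
    (h.hf.differentiable one_ne_zero) (convex_closedBall (0 : X) (R + 1)) hK
    (x := x k) (y := y) (by simpa using (hR k).trans (by linarith)) (by simp; linarith)
  have hKσ : (K : ℝ) ≤ αmin / (2 * σ) := by
    have := hσlt.le.trans (min_le_right _ _)
    rw [le_div_iff₀ (by positivity)] at this ⊢
    linarith
  have hKd : K * d ^ 2 ≤ d ^ 2 / (2 * σ) - (1 - αmin) / (2 * σ) * d ^ 2 := by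
    calc K * d ^ 2 ≤ αmin / (2 * σ) * d ^ 2 := by gcongr
      _ = _ := by ring
  have hrej' : Φ k - (1 - αmin) / (2 * σ) * d ^ 2 < f y + G := by
    rw [phiE, ← hgy] at hrej
    exact_mod_cast hrej
  linarith [h.objective_le_merit k]

theorem sum_sq_residual_le (h : NMPG f g γmax αmin αmax pmin x γ α p Φ) {γstar : ℝ}
    (hγstar : 0 < γstar) (hγ : ∀ k, γstar ≤ γ (k + 1)) (n : ℕ) :
    ∑ j ∈ Finset.range n, (‖x (j + 1) - x j‖ / γ (j + 1)) ^ 2 ≤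
      2 * (Φ 0 - Φ n) / (γstar * pmin * (1 - αmax)) := by
  have hαmax : 0 < 1 - αmax := sub_pos.2 h.hαmax
  have hpmin := h.hpmin
  rw [← Finset.sum_range_sub', Finset.mul_sum, Finset.sum_div]
  refine Finset.sum_le_sum fun j _ => ?_
  have hγj := h.hγpos (j + 1)
  rw [le_div_iff₀ (by positivity)]
  have h1 := h.sufficient_decrease j
  calc (‖x (j + 1) - x j‖ / γ (j + 1)) ^ 2 * (γstar * pmin * (1 - αmax))
      ≤ (‖x (j + 1) - x j‖ / γ (j + 1)) ^ 2 * (γ (j + 1) * pmin * (1 - αmax)) := by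
        gcongr
        exact hγ j
    _ = 2 * (pmin * ((1 - αmax) / (2 * γ (j + 1)) * ‖x (j + 1) - x j‖ ^ 2)) := by
        field_simp
    _ ≤ _ := by linarith

end NMPG

theorem stmt_14 (f : X → ℝ) (g : X → EReal) (γmax αmin αmax pmin : ℝ)
    (x : ℕ → X) (γ α p : ℕ → ℝ) (Φ : ℕ → ℝ)
    (h : NMPG f g γmax αmin αmax pmin x γ α p Φ)
    (γmin βmin βmax : ℝ) (hγmin : 0 < γmin) (hβmin : 0 < βmin)
    (hββ : βmin ≤ βmax) (hβmax : βmax < 1)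
    (hbt : Backtrack f g αmin γmin βmin βmax x γ Φ)
    (hLip : LocallyLipschitz (gradient f))
    (φstar : ℝ) (hΦlim : Tendsto Φ atTop (𝓝 φstar))
    (hacc_ne : ({y : X | ∃ ks : ℕ → ℕ, StrictMono ks ∧ Tendsto (fun j => x (ks j)) atTop (𝓝 y)} : Set X).Nonempty)
    (hacc_bdd : Bornology.IsBounded ({y : X | ∃ ks : ℕ → ℕ, StrictMono ks ∧ Tendsto (fun j => x (ks j)) atTop (𝓝 y)} : Set X)) :
    ∃ γstar : ℝ, 0 < γstar ∧ (∀ k : ℕ, 1 ≤ k → γstar ≤ γ k) ∧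
      ∀ (k : ℕ) (hk : 1 ≤ k),
        (Finset.Icc 1 k).inf' (Finset.nonempty_Icc.mpr hk)
            (fun j => ‖x j - x (j - 1)‖ / γ j) ≤
          1 / Real.sqrt k *
            Real.sqrt (2 * (f (x 0) + (g (x 0)).toReal - φstar) /
              (γstar * pmin * (1 - αmax))) := by
  obtain ⟨R, hR⟩ := exists_norm_le_of_steps_tendsto_zero (h.tendsto_step_zero hΦlim)
    hacc_ne hacc_bdd
  obtain ⟨γstar, hpos, hle⟩ :=
    h.exists_stepsize_lower_bound hγmin hβmin hββ hbt hLip hR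
  refine ⟨γstar, hpos, fun k hk => ?_, fun k hk => ?_⟩
  · obtain ⟨j, rfl⟩ := Nat.exists_eq_add_of_le' hk
    exact hle j
  have hαmax : 0 < 1 - αmax := sub_pos.2 h.hαmax
  have hpmin := h.hpmin
  set μ := (Finset.Icc 1 k).inf' (Finset.nonempty_Icc.mpr hk)
    (fun j => ‖x j - x (j - 1)‖ / γ j) with hμ
  have hμ0 : 0 ≤ μ :=
    Finset.le_inf' _ _ fun j _ => div_nonneg (norm_nonneg _) (h.hγpos j).le
  have hμle : ∀ j ∈ Finset.range k, μ ^ 2 ≤ (‖x (j + 1) - x j‖ / γ (j + 1)) ^ 2 := by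
    intro j hj
    have hj' : j + 1 ∈ Finset.Icc 1 k := by
      simp only [Finset.mem_range, Finset.mem_Icc] at hj ⊢
      lia
    gcongr
    exact Finset.inf'_le (fun j => ‖x j - x (j - 1)‖ / γ j) hj'
  have hsum := Finset.card_nsmul_le_sum _ _ _ hμle
  rw [Finset.card_range, nsmul_eq_mul] at hsum
  have hkpos : (0 : ℝ) < k := by exact_mod_cast hk
  rw [one_div_mul_eq_div, ← Real.sqrt_div' _ hkpos.le]
  refine Real.le_sqrt_of_sq_le ?_
  rw [le_div_iff₀ hkpos, mul_comm]
  refine hsum.trans ((h.sum_sq_residual_le hpos hle k).trans ?_)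
  rw [h.merit_zero]
  gcongr
  exact h.merit_antitone.le_of_tendsto hΦlim k
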